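/- Let B be a finite structure over a finite relational signature σ, and suppose β₁,…,β_k are nonzero rational numbers and B₁,…,B_k are pairwise non-isomorphic finite σ-structures such that for every finite σ-structure A, Condens(A,B) = Σ_{i=1}^k β_i · hom(A,B_i). Then there exists an index i such that B_i is isomorphic to B and β_i = 1. -/

import Mathlib

/-- A finite relational signature: a finite set of relation symbols with arities. -/
structure Sig where
  symb : Type
  [fin : Finite symb]
  ar : symb → ℕ

attribute [instance] Sig.fin

/-- A finite structure over the signature `σ`. -/
structure Str (σ : Sig) where
  carrier : Type
  [fin : Finite carrier]
  rel : ∀ R : σ.symb, Set (Fin (σ.ar R) → carrier)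

attribute [instance] Str.fin

variable {σ : Sig}

/-- `h` is a homomorphism from `A` to `B`. -/
def IsHom (A B : Str σ) (h : A.carrier → B.carrier) : Prop :=
  ∀ R : σ.symb, ∀ t ∈ A.rel R, (h ∘ t) ∈ B.rel R

/-- `h` is a surjective homomorphism from `A` to `B`. -/
def IsSurjHom (A B : Str σ) (h : A.carrier → B.carrier) : Prop :=
  IsHom A B h ∧ Function.Surjective h

/-- `h` is a condensation from `A` to `B`. -/
def IsCondens (A B : Str σ) (h : A.carrier → B.carrier) : Prop :=
  IsSurjHom A B h ∧ ∀ R : σ.symb, (fun t => h ∘ t) '' A.rel R = B.rel R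

/-- The number of homomorphisms from `A` to `B`. -/
noncomputable def homCount (A B : Str σ) : ℕ := Nat.card {h : A.carrier → B.carrier // IsHom A B h}

/-- The number of surjective homomorphisms from `A` to `B`. -/
noncomputable def surjHomCount (A B : Str σ) : ℕ :=
  Nat.card {h : A.carrier → B.carrier // IsSurjHom A B h}

/-- The number of condensations from `A` to `B`. -/
noncomputable def condensCount (A B : Str σ) : ℕ :=
  Nat.card {h : A.carrier → B.carrier // IsCondens A B h}

/-- Isomorphism of structures. -/
def Iso (A B : Str σ) : Prop :=
  ∃ e : A.carrier ≃ B.carrier, ∀ (R : σ.symb) (t : Fin (σ.ar R) → A.carrier),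
    t ∈ A.rel R ↔ (⇑e ∘ t) ∈ B.rel R

/-- Homomorphic equivalence of structures. -/
def HomEquiv (A B : Str σ) : Prop :=
  (∃ h, IsHom A B h) ∧ (∃ h, IsHom B A h)

/-- The induced substructure of `B` on the subset `S`. -/
def induced (B : Str σ) (S : Set B.carrier) : Str σ where
  carrier := S
  rel R := {t | (fun i => (t i).val) ∈ B.rel R}

/-- The number of subsets `S` of the universe of `B` with `B[S]` isomorphic to `B'`. -/
noncomputable def indsubCount (B' B : Str σ) : ℕ :=
  Nat.card {S : Set B.carrier // Iso (induced B S) B'}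

/-- The deduct of `B` given by a family of subrelations `r`. -/
def deduct (B : Str σ) (r : ∀ R : σ.symb, Set (Fin (σ.ar R) → B.carrier)) : Str σ where
  carrier := B.carrier
  rel := r

/-- `C` is a deduct of `B`. -/
def IsDeductOf (C B : Str σ) : Prop :=
  ∃ r : ∀ R : σ.symb, Set (Fin (σ.ar R) → B.carrier),
    (∀ R, r R ⊆ B.rel R) ∧ C = deduct B r

/-- The number of deducts of `B` isomorphic to `B'`. -/
noncomputable def deductsCount (B' B : Str σ) : ℕ :=
  Nat.card {r : ∀ R : σ.symb, Set (Fin (σ.ar R) → B.carrier) //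
    (∀ R, r R ⊆ B.rel R) ∧ Iso (deduct B r) B'}

/-- The disjoint union of two structures. -/
def disjUnion (A₁ A₂ : Str σ) : Str σ where
  carrier := A₁.carrier ⊕ A₂.carrier
  rel R := (fun t => Sum.inl ∘ t) '' A₁.rel R ∪ (fun t => Sum.inr ∘ t) '' A₂.rel R

/-- The `N`-fold disjoint union of `A` with itself. -/
def nCopies (N : ℕ) (A : Str σ) : Str σ where
  carrier := Fin N × A.carrier
  rel R := {t | ∃ j : Fin N, ∃ s ∈ A.rel R, t = fun i => (j, s i)}

/-- The total size of a structure: universe size plus sizes of all relations. -/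
noncomputable def totalSize (B : Str σ) : ℕ :=
  Nat.card B.carrier + ∑ᶠ R : σ.symb, (B.rel R).ncard

/-- The quotient of `A` by `s`, carrying the images of the relations of `A`. -/
def quotientStr (A : Str σ) (s : Setoid A.carrier) : Str σ where
  carrier := Quotient s
  rel R := (fun t => Quotient.mk s ∘ t) '' A.rel R

theorem isHom_quotientStr (A D : Str σ) (s : Setoid A.carrier) (g : Quotient s → D.carrier) :
    IsHom (quotientStr A s) D g ↔ IsHom A D (g ∘ Quotient.mk s) :=
  forall_congr' fun _ => Set.forall_mem_image

theorem isCondens_quotientStr (A D : Str σ) (s : Setoid A.carrier) (g : Quotient s → D.carrier) :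
    IsCondens (quotientStr A s) D g ↔ IsCondens A D (g ∘ Quotient.mk s) := by
  have hs : Function.Surjective g ↔ Function.Surjective (g ∘ Quotient.mk s) :=
    (Quotient.mk_surjective.of_comp_iff g).symm
  unfold IsCondens IsSurjHom
  rw [isHom_quotientStr, ← hs]
  simp only [quotientStr, Set.image_image]
  rfl

/-- Maps with kernel `s` correspond to injective maps from the quotient by `s`. -/
theorem card_ker_eq (A D : Str σ) (P : ∀ A : Str σ, (A.carrier → D.carrier) → Prop)
    (hP : ∀ (A : Str σ) (s : Setoid A.carrier) (g : Quotient s → D.carrier),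
      P (quotientStr A s) g ↔ P A (g ∘ Quotient.mk s)) (s : Setoid A.carrier) :
    Nat.card {h : {h : A.carrier → D.carrier // P A h} // Setoid.ker h.1 = s} =
      Nat.card {g : (quotientStr A s).carrier → D.carrier //
        P (quotientStr A s) g ∧ Function.Injective g} := by
  symm
  refine Nat.card_congr (Equiv.ofBijective
    (fun g => ⟨⟨g.1 ∘ Quotient.mk s, (hP A s g.1).1 g.2.1⟩, ?_⟩) ⟨?_, ?_⟩)
  · ext x y
    exact g.2.2.eq_iff.trans Quotient.eq
  · intro g g' h
    refine Subtype.ext (Quotient.mk_surjective.injective_comp_right ?_)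
    exact congrArg (fun h => h.1.1) h
  · rintro ⟨⟨h, hh⟩, rfl⟩
    refine ⟨⟨Quotient.lift h fun _ _ => id, (hP A _ _).2 hh, ?_⟩, rfl⟩
    exact Setoid.kerLift_injective h

theorem card_ker_bot (A D : Str σ) (P : (A.carrier → D.carrier) → Prop) :
    Nat.card {h : {h : A.carrier → D.carrier // P h} // Setoid.ker h.1 = ⊥} =
      Nat.card {h : A.carrier → D.carrier // P h ∧ Function.Injective h} := by
  simp only [← Setoid.injective_iff_ker_bot]
  exact Nat.card_congr (Equiv.subtypeSubtypeEquivSubtypeInter P Function.Injective)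

theorem card_eq_sum_ker {α β : Type*} [Finite α] [Finite β] [Fintype (Setoid α)]
    (P : (α → β) → Prop) :
    Nat.card {h // P h} = ∑ s, Nat.card {h : {h // P h} // Setoid.ker h.1 = s} := by
  rw [← Nat.card_sigma]
  exact Nat.card_congr (Equiv.sigmaFiberEquiv _).symm

theorem card_quotient_lt {α : Type*} [Finite α] {s : Setoid α} (hs : s ≠ ⊥) :
    Nat.card (Quotient s) < Nat.card α := by
  refine lt_of_le_of_ne (Nat.card_le_card_of_surjective _ Quotient.mk_surjective) fun h => hs ?_
  have hb : Function.Bijective (Quotient.mk s) :=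
    (Nat.bijective_iff_surjective_and_card _).2 ⟨Quotient.mk_surjective, h.symm⟩
  rw [← Setoid.ker_mk_eq s]
  exact (Setoid.injective_iff_ker_bot _).1 hb.1

/-- A linear identity between condensation and homomorphism counts restricts to injective maps. -/
theorem injective_count_eq {ι : Type*} [Fintype ι] (B : Str σ) (β : ι → ℚ) (Bs : ι → Str σ)
    (heq : ∀ A : Str σ, (condensCount A B : ℚ) = ∑ i, β i * (homCount A (Bs i) : ℚ))
    (A : Str σ) :
    (Nat.card {h // IsCondens A B h ∧ Function.Injective h} : ℚ) =
      ∑ i, β i * (Nat.card {h // IsHom A (Bs i) h ∧ Function.Injective h} : ℚ) := by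
  classical
  induction A using (measure fun A : Str σ => Nat.card A.carrier).wf.induction with
  | _ A ih =>
  have : Finite (Setoid A.carrier) :=
    Finite.of_injective (fun s x y => s x y) fun _ _ h => Setoid.ext fun x y =>
      iff_of_eq (congrFun₂ h x y)
  have := Fintype.ofFinite (Setoid A.carrier)
  have h := heq A
  simp only [condensCount, homCount, card_eq_sum_ker, Nat.cast_sum, Finset.mul_sum] at h
  rw [Finset.sum_comm, ← Finset.add_sum_erase _ _ (Finset.mem_univ (⊥ : Setoid A.carrier)),
    ← Finset.add_sum_erase _ _ (Finset.mem_univ (⊥ : Setoid A.carrier))] at h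
  simp only [card_ker_bot] at h
  refine add_right_cancel (h.trans (congrArg _ (Finset.sum_congr rfl fun s hs => ?_)))
  rw [card_ker_eq A B (fun A => IsCondens A B) (fun A => isCondens_quotientStr A B)]
  simp only [fun i => card_ker_eq A (Bs i) (fun A => IsHom A (Bs i))
    (fun A => isHom_quotientStr A (Bs i))]
  exact (ih (quotientStr A s) (card_quotient_lt (Finset.ne_of_mem_erase hs))).symm

theorem IsHom.comp {A B C : Str σ} {g : B.carrier → C.carrier} {h : A.carrier → B.carrier}
    (hg : IsHom B C g) (hh : IsHom A B h) : IsHom A C (g ∘ h) :=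
  fun R t ht => hg R _ (hh R t ht)

theorem IsHom.iterate {A : Str σ} {h : A.carrier → A.carrier} (hh : IsHom A A h) (n : ℕ) :
    IsHom A A h^[n] := by
  induction n with
  | zero => exact fun _ _ ht => ht
  | succ n ih => exact ih.comp hh

/-- An injective endomorphism reflects all relations. -/
theorem IsHom.mem_of_comp_mem {A : Str σ} {h : A.carrier → A.carrier} (hh : IsHom A A h)
    (hi : Function.Injective h) (R : σ.symb) (t : Fin (σ.ar R) → A.carrier)
    (ht : h ∘ t ∈ A.rel R) : t ∈ A.rel R := by
  obtain ⟨n, hn, hp⟩ :=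
    (isOfFinOrder_of_finite (Equiv.ofBijective h hi.bijective_of_finite)).exists_pow_eq_one
  obtain ⟨n, rfl⟩ := Nat.exists_eq_add_of_lt hn
  have hid : h^[n] ∘ h = id := by
    rw [← Function.iterate_succ]
    funext x
    have := DFunLike.congr_fun hp x
    rwa [Equiv.Perm.coe_pow, zero_add] at this
  have := hh.iterate n R _ ht
  rwa [← Function.comp_assoc, hid] at this

theorem iso_of_injective_isHom {A B : Str σ} {g : B.carrier → A.carrier}
    {h : A.carrier → B.carrier} (hg : IsHom B A g) (hgi : Function.Injective g)
    (hh : IsHom A B h) (hhi : Function.Injective h) : Iso A B := by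
  refine ⟨Equiv.ofBijective h ((Nat.bijective_iff_injective_and_card h).2 ⟨hhi, le_antisymm
    (Nat.card_le_card_of_injective h hhi) (Nat.card_le_card_of_injective g hgi)⟩),
    fun R t => ⟨hh R t, fun ht => ?_⟩⟩
  exact (hg.comp hh).mem_of_comp_mem (hgi.comp hhi) R t (hg R _ ht)

theorem IsCondens.iso {A B : Str σ} {h : A.carrier → B.carrier} (hh : IsCondens A B h)
    (hi : Function.Injective h) : Iso A B := by
  refine ⟨Equiv.ofBijective h ⟨hi, hh.1.2⟩, fun R t => ⟨hh.1.1 R t, fun ht => ?_⟩⟩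
  rw [← hh.2 R] at ht
  obtain ⟨u, hu, hut⟩ := ht
  rwa [← hi.comp_left hut]

/-- An injective endomorphism is a condensation. -/
theorem isCondens_self_iff {A : Str σ} {h : A.carrier → A.carrier} (hi : Function.Injective h) :
    IsCondens A A h ↔ IsHom A A h := by
  refine ⟨fun hh => hh.1.1, fun hh => ⟨⟨hh, hi.bijective_of_finite.2⟩, fun R => ?_⟩⟩
  refine Set.Subset.antisymm (Set.image_subset_iff.2 (hh R)) fun t ht => ?_
  obtain ⟨u, rfl⟩ := hi.bijective_of_finite.2.comp_left t
  exact ⟨u, hh.mem_of_comp_mem hi R u ht, rfl⟩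

theorem isCondens_equiv_comp {A B C : Str σ} (e : B.carrier ≃ C.carrier)
    (he : ∀ R (t : Fin (σ.ar R) → B.carrier), t ∈ B.rel R ↔ e ∘ t ∈ C.rel R)
    (h : A.carrier → B.carrier) : IsCondens A B h ↔ IsCondens A C (e ∘ h) := by
  have hrel : ∀ R, C.rel R = (fun t => e ∘ t) '' B.rel R := fun R => by
    ext t
    refine ⟨fun ht => ⟨e.symm ∘ t, (he R _).2 ?_, ?_⟩, ?_⟩
    · rwa [← Function.comp_assoc, e.self_comp_symm]
    · exact funext fun i => e.apply_symm_apply _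
    · rintro ⟨u, hu, rfl⟩
      exact (he R u).1 hu
  refine and_congr (and_congr ?_ (e.comp_surjective h).symm) (forall_congr' fun R => ?_)
  · exact forall_congr' fun R => forall₂_congr fun t _ => he R _
  · rw [hrel, ← (e.injective.comp_left.image_injective).eq_iff, Set.image_image]
    rfl

theorem card_injective_isCondens_of_iso {A B : Str σ} (hAB : Iso A B) :
    Nat.card {h // IsCondens A B h ∧ Function.Injective h} =
      Nat.card {h // IsHom A A h ∧ Function.Injective h} := by
  obtain ⟨e, he⟩ := hAB
  refine (Nat.card_congr (Equiv.subtypeEquiv (Equiv.arrowCongr (Equiv.refl _) e)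
    fun h => ?_)).symm
  have h₁ : Function.Injective (e ∘ h) ↔ Function.Injective h := e.comp_injective h
  have h₂ := isCondens_equiv_comp e he h
  change _ ↔ IsCondens A B (e ∘ h) ∧ Function.Injective (e ∘ h)
  rw [h₁, ← h₂]
  exact and_congr_left fun hi => (isCondens_self_iff hi).symm

/-- Structures preordered by the existence of an injective homomorphism. -/
abbrev strPreorder (σ : Sig) : Preorder (Str σ) where
  le A B := ∃ h, IsHom A B h ∧ Function.Injective h
  le_refl _ := ⟨id, fun _ _ ht => ht, Function.injective_id⟩
  le_trans _ _ _ := fun ⟨h, hh, hi⟩ ⟨g, hg, hgi⟩ => ⟨g ∘ h, hg.comp hh, hgi.comp hi⟩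

/-- in any expression of Condens(·,B) as a linear combination of
homomorphism-counting functions, hom(·,B) occurs with coefficient 1. -/
theorem stmt_14 (σ : Sig) (B : Str σ) (k : ℕ) (β : Fin k → ℚ) (Bs : Fin k → Str σ)
    (hβ : ∀ i, β i ≠ 0)
    (hB : ∀ i j, i ≠ j → ¬ Iso (Bs i) (Bs j))
    (heq : ∀ A : Str σ, (condensCount A B : ℚ) = ∑ i, β i * (homCount A (Bs i) : ℚ)) :
    ∃ i, Iso (Bs i) B ∧ β i = 1 := by
  have hne : (Finset.univ : Finset (Fin k)).Nonempty := by
    rw [Finset.nonempty_iff_ne_empty]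
    intro h
    have hz := heq B
    rw [h, Finset.sum_empty, Nat.cast_eq_zero] at hz
    refine Nat.card_ne_zero.2 ⟨⟨id, ?_⟩, inferInstance⟩ hz
    exact (isCondens_self_iff Function.injective_id).2 fun _ _ ht => ht
  let := strPreorder σ
  obtain ⟨i, -, hmax⟩ := Finset.exists_maximalFor Bs _ hne
  have h := injective_count_eq B β Bs heq (Bs i)
  rw [Finset.sum_eq_single_of_mem i (Finset.mem_univ i)] at h
  · have hpos : (Nat.card {h // IsHom (Bs i) (Bs i) h ∧ Function.Injective h} : ℚ) ≠ 0 :=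
      Nat.cast_ne_zero.2 (Nat.card_ne_zero.2
        ⟨⟨id, fun _ _ ht => ht, Function.injective_id⟩, inferInstance⟩)
    have hc := Nat.cast_ne_zero.1 (h.trans_ne (mul_ne_zero (hβ i) hpos))
    obtain ⟨⟨g, hg, hgi⟩⟩ := (Nat.card_ne_zero.1 hc).1
    refine ⟨i, hg.iso hgi, ?_⟩
    rw [card_injective_isCondens_of_iso (hg.iso hgi)] at h
    exact (mul_eq_right₀ hpos).1 h.symm
  · intro j _ hj
    refine mul_eq_zero_of_right _ (Nat.cast_eq_zero.2 (Nat.card_eq_zero.2 (Or.inl ⟨?_⟩)))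
    rintro ⟨g, hg, hgi⟩
    obtain ⟨f, hf, hfi⟩ := hmax (Finset.mem_univ j) ⟨g, hg, hgi⟩
    exact hB i j hj.symm (iso_of_injective_isHom hf hfi hg hgi)
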